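/- arXiv:2207.07500 — 2 statements merged into one kernel-verified Lean document; each statement's English description precedes it below -/
import Mathlib

section
/- (Corollary 2) With Ā the reduced matrix and J̄_i = {j : ā_ij ≥ b_i}, every minimal element of S equals X(e) for some selection e with e(i) ∈ J̄_i for all i, and moreover J̄_i ⊆ J_i for every i, so that {X(e) : e(i) ∈ J̄_i for all i} ⊆ {X(e) : e(i) ∈ J_i for all i}. -/
open scoped Classical

/-- The Dombi t-norm with parameter `l`. -/
noncomputable def dombi (l x y : ℝ) : ℝ :=
  if x = 0 ∨ y = 0 then 0
  else (1 + (((1 - x) / x) ^ l + ((1 - y) / y) ^ l) ^ (1 / l))⁻¹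

/-- The solving operation `V(b, a)` associated with the Dombi t-norm. -/
noncomputable def V (l b a : ℝ) : ℝ :=
  (1 + (((1 - b) / b) ^ l - ((1 - a) / a) ^ l) ^ (1 / l))⁻¹

/-- The feasible set `S` of the max-Dombi system `A φ x = b` inside `[0,1]^n`. -/
def feasible (l : ℝ) {m n : ℕ} (A : Fin (m + 1) → Fin (n + 1) → ℝ)
    (b : Fin (m + 1) → ℝ) : Set (Fin (n + 1) → ℝ) :=
  {x | (∀ j, x j ∈ Set.Icc (0 : ℝ) 1) ∧
    ∀ i, Finset.univ.sup' Finset.univ_nonempty (fun j => dombi l (A i j) (x j)) = b i}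

/-- The vector `x̌ᵢ(j)`: its `k`-th component is `V(bᵢ, aᵢⱼ)` if `bᵢ > 0` and `k = j`,
and `0` otherwise. -/
noncomputable def xcheck (l : ℝ) {m n : ℕ} (A : Fin (m + 1) → Fin (n + 1) → ℝ)
    (b : Fin (m + 1) → ℝ) (i : Fin (m + 1)) (j k : Fin (n + 1)) : ℝ :=
  if 0 < b i ∧ k = j then V l (b i) (A i j) else 0

/-- The candidate minimal solution `X(e)` associated with a selection `e`. -/
noncomputable def Xe (l : ℝ) {m n : ℕ} (A : Fin (m + 1) → Fin (n + 1) → ℝ)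
    (b : Fin (m + 1) → ℝ) (e : Fin (m + 1) → Fin (n + 1)) (j : Fin (n + 1)) : ℝ :=
  Finset.univ.sup' Finset.univ_nonempty (fun i => xcheck l A b i (e i) j)

/-- The reduced matrix `Ā` obtained from `A` by the simplification steps
(I), (II) and (III) of Theorem 1. -/
noncomputable def Abar (l : ℝ) {m n : ℕ} (A : Fin (m + 1) → Fin (n + 1) → ℝ)
    (b : Fin (m + 1) → ℝ) (i : Fin (m + 1)) (j : Fin (n + 1)) : ℝ :=
  if A i j < b i then 0
  else if 0 < b i ∧ ∃ i', i' ≠ i ∧ 0 < b i' ∧ b i' ≤ A i' j ∧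
      V l (b i') (A i' j) < V l (b i) (A i j) then 0
  else if 0 < b i ∧ ∃ i', i' ≠ i ∧ b i' = 0 ∧ 0 < A i' j then 0
  else A i j

lemma inv_one_add_odds {x : ℝ} (hx : 0 < x) : (1 + (1 - x) / x)⁻¹ = x := by
  field_simp
  ring

lemma odds_nonneg {x : ℝ} (hx : x ∈ Set.Icc (0 : ℝ) 1) : 0 ≤ (1 - x) / x :=
  div_nonneg (by linarith [hx.2]) hx.1

lemma odds_le_odds {x y : ℝ} (hx : 0 < x) (hxy : x ≤ y) : (1 - y) / y ≤ (1 - x) / x := by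
  rw [div_le_div_iff₀ (hx.trans_le hxy) hx]
  nlinarith

lemma dombi_of_pos {l x y : ℝ} (hx : 0 < x) (hy : 0 < y) :
    dombi l x y = (1 + (((1 - x) / x) ^ l + ((1 - y) / y) ^ l) ^ (1 / l))⁻¹ := by
  simp [dombi, hx.ne', hy.ne']

lemma dombi_zero_right (l x : ℝ) : dombi l x 0 = 0 := by simp [dombi]

lemma dombi_sum_nonneg {l x y : ℝ} (hx : x ∈ Set.Icc (0 : ℝ) 1) (hy : y ∈ Set.Icc (0 : ℝ) 1) :
    0 ≤ ((1 - x) / x) ^ l + ((1 - y) / y) ^ l :=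
  add_nonneg (Real.rpow_nonneg (odds_nonneg hx) l) (Real.rpow_nonneg (odds_nonneg hy) l)

lemma dombi_pos {l x y : ℝ} (hx : x ∈ Set.Icc (0 : ℝ) 1) (hy : y ∈ Set.Icc (0 : ℝ) 1)
    (hx0 : 0 < x) (hy0 : 0 < y) : 0 < dombi l x y := by
  rw [dombi_of_pos hx0 hy0]
  have := Real.rpow_nonneg (dombi_sum_nonneg (l := l) hx hy) (1 / l)
  positivity

lemma pos_of_dombi_pos {l x y : ℝ} (hx : 0 ≤ x) (hy : 0 ≤ y) (h : 0 < dombi l x y) :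
    0 < x ∧ 0 < y := by
  by_cases h0 : x = 0 ∨ y = 0
  · simp [dombi, h0] at h
  · push Not at h0
    exact ⟨hx.lt_of_ne' h0.1, hy.lt_of_ne' h0.2⟩

/-- The Dombi t-norm is additive in the variable `((1 - x) / x) ^ l`. -/
lemma odds_dombi_rpow {l x y : ℝ} (hl : 0 < l) (hx : x ∈ Set.Icc (0 : ℝ) 1)
    (hy : y ∈ Set.Icc (0 : ℝ) 1) (hx0 : 0 < x) (hy0 : 0 < y) :
    ((1 - dombi l x y) / dombi l x y) ^ l = ((1 - x) / x) ^ l + ((1 - y) / y) ^ l := by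
  have hs := dombi_sum_nonneg (l := l) hx hy
  have ht := Real.rpow_nonneg hs (1 / l)
  have h : (1 - dombi l x y) / dombi l x y =
      (((1 - x) / x) ^ l + ((1 - y) / y) ^ l) ^ (1 / l) := by
    rw [dombi_of_pos hx0 hy0]
    field_simp
    ring
  rw [h, ← Real.rpow_mul hs, one_div_mul_cancel hl.ne', Real.rpow_one]

lemma dombi_le_left {l x y : ℝ} (hl : 0 < l) (hx : x ∈ Set.Icc (0 : ℝ) 1)
    (hy : y ∈ Set.Icc (0 : ℝ) 1) (hx0 : 0 < x) (hy0 : 0 < y) : dombi l x y ≤ x := by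
  by_contra! h
  have h1 := odds_dombi_rpow hl hx hy hx0 hy0
  have h2 : (1 - dombi l x y) / dombi l x y < (1 - x) / x := by
    rw [div_lt_div_iff₀ (hx0.trans h) hx0]
    nlinarith
  have h3 : dombi l x y ≤ 1 := by
    rw [dombi_of_pos hx0 hy0]
    exact inv_le_one_of_one_le₀
      (by linarith [Real.rpow_nonneg (dombi_sum_nonneg (l := l) hx hy) (1 / l)])
  have h4 := Real.rpow_lt_rpow (odds_nonneg ⟨(hx0.trans h).le, h3⟩) h2 hl
  linarith [Real.rpow_nonneg (odds_nonneg hy) l]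

/-- For a positive value, the equation `dombi l a x = b` has at most the solution `V l b a`. -/
lemma V_dombi {l a x : ℝ} (hl : 0 < l) (ha : a ∈ Set.Icc (0 : ℝ) 1)
    (hx : x ∈ Set.Icc (0 : ℝ) 1) (ha0 : 0 < a) (hx0 : 0 < x) : V l (dombi l a x) a = x := by
  rw [V, odds_dombi_rpow hl ha hx ha0 hx0, add_sub_cancel_left,
    ← Real.rpow_mul (odds_nonneg hx), mul_one_div_cancel hl.ne', Real.rpow_one,
    inv_one_add_odds hx0]

lemma lt_dombi_of_V_lt {l a b x : ℝ} (hl : 0 < l) (ha : a ∈ Set.Icc (0 : ℝ) 1)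
    (hx : x ∈ Set.Icc (0 : ℝ) 1) (hb0 : 0 < b) (hba : b ≤ a) (h : V l b a < x) :
    b < dombi l a x := by
  have ha0 := hb0.trans_le hba
  have hab := Real.rpow_le_rpow (odds_nonneg ha) (odds_le_odds hb0 hba) hl.le
  have ht := sub_nonneg.2 hab
  have hu := Real.rpow_nonneg ht (1 / l)
  have hx0 : 0 < x := lt_trans (by unfold V; positivity) h
  have h1 : (1 - x) / x < (((1 - b) / b) ^ l - ((1 - a) / a) ^ l) ^ (1 / l) := by
    rw [V, ← inv_one_add_odds hx0,
      inv_lt_inv₀ (by positivity) (by linarith [odds_nonneg hx])] at h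
    linarith
  have h2 := Real.rpow_lt_rpow (odds_nonneg hx) h1 hl
  rw [← Real.rpow_mul ht, one_div_mul_cancel hl.ne', Real.rpow_one, lt_sub_iff_add_lt',
    ← odds_dombi_rpow hl ha hx ha0 hx0] at h2
  by_contra! hle
  exact h2.not_ge (Real.rpow_le_rpow (odds_nonneg ⟨hb0.le, hba.trans ha.2⟩)
    (odds_le_odds (dombi_pos ha hx ha0 hx0) hle) hl.le)

section System

variable {l : ℝ} {m n : ℕ} {A : Fin (m + 1) → Fin (n + 1) → ℝ} {b : Fin (m + 1) → ℝ}
  {x : Fin (n + 1) → ℝ}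

lemma dombi_le_of_feasible (hx : x ∈ feasible l A b) (i : Fin (m + 1)) (j : Fin (n + 1)) :
    dombi l (A i j) (x j) ≤ b i :=
  hx.2 i ▸ Finset.le_sup' (fun j => dombi l (A i j) (x j)) (Finset.mem_univ j)

lemma exists_dombi_eq_of_feasible (hx : x ∈ feasible l A b) (i : Fin (m + 1)) :
    ∃ j, dombi l (A i j) (x j) = b i := by
  obtain ⟨j, -, hj⟩ := Finset.exists_mem_eq_sup' Finset.univ_nonempty
    (fun j => dombi l (A i j) (x j))
  exact ⟨j, hj.symm.trans (hx.2 i)⟩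

lemma le_of_le_Abar (hA : ∀ i j, A i j ∈ Set.Icc (0 : ℝ) 1) {i : Fin (m + 1)}
    {j : Fin (n + 1)} (h : b i ≤ Abar l A b i j) : b i ≤ A i j := by
  by_contra! hlt
  rw [Abar, if_pos hlt] at h
  linarith [(hA i j).1]

lemma V_eq_of_dombi_eq (hl : 0 < l) (hA : ∀ i j, A i j ∈ Set.Icc (0 : ℝ) 1)
    (hx : x ∈ feasible l A b) {i : Fin (m + 1)} {j : Fin (n + 1)}
    (h : dombi l (A i j) (x j) = b i) (h0 : 0 < b i) : V l (b i) (A i j) = x j := by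
  obtain ⟨ha0, hx0⟩ := pos_of_dombi_pos (hA i j).1 (hx.1 j).1 (h ▸ h0)
  exact h ▸ V_dombi hl (hA i j) (hx.1 j) ha0 hx0

/-- An index attaining the maximum in row `i` survives the reduction of the matrix. -/
lemma le_Abar_of_dombi_eq (hl : 0 < l) (hA : ∀ i j, A i j ∈ Set.Icc (0 : ℝ) 1)
    (hb : ∀ i, b i ∈ Set.Icc (0 : ℝ) 1) (hx : x ∈ feasible l A b) {i : Fin (m + 1)}
    {j : Fin (n + 1)} (h : dombi l (A i j) (x j) = b i) : b i ≤ Abar l A b i j := by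
  rcases (hb i).1.eq_or_lt with h0 | h0
  · simp [Abar, ← h0, (hA i j).1, (hA i j).1.not_gt]
  obtain ⟨ha0, hx0⟩ := pos_of_dombi_pos (hA i j).1 (hx.1 j).1 (h ▸ h0)
  have hle : b i ≤ A i j := h ▸ dombi_le_left hl (hA i j) (hx.1 j) ha0 hx0
  have hV := V_eq_of_dombi_eq hl hA hx h h0
  rw [Abar, if_neg hle.not_gt, if_neg, if_neg]
  · exact hle
  · rintro ⟨-, i', -, hb', ha'⟩
    exact (dombi_pos (hA i' j) (hx.1 j) ha' hx0).not_ge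
      (hb' ▸ dombi_le_of_feasible hx i' j)
  · rintro ⟨-, i', -, hb', ha', hlt⟩
    exact (lt_dombi_of_V_lt hl (hA i' j) (hx.1 j) hb' ha' (hV ▸ hlt)).not_ge
      (dombi_le_of_feasible hx i' j)

variable {e : Fin (m + 1) → Fin (n + 1)}

lemma xcheck_eq_ite (hl : 0 < l) (hA : ∀ i j, A i j ∈ Set.Icc (0 : ℝ) 1)
    (hx : x ∈ feasible l A b) (he : ∀ i, dombi l (A i (e i)) (x (e i)) = b i)
    (i : Fin (m + 1)) (j : Fin (n + 1)) :
    xcheck l A b i (e i) j = if 0 < b i ∧ j = e i then x j else 0 := by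
  unfold xcheck
  split_ifs with h
  · rw [h.2, V_eq_of_dombi_eq hl hA hx (he i) h.1]
  · rfl

lemma Xe_le (hl : 0 < l) (hA : ∀ i j, A i j ∈ Set.Icc (0 : ℝ) 1)
    (hx : x ∈ feasible l A b) (he : ∀ i, dombi l (A i (e i)) (x (e i)) = b i)
    (j : Fin (n + 1)) : Xe l A b e j ≤ x j := by
  refine Finset.sup'_le _ _ fun i _ => ?_
  rw [xcheck_eq_ite hl hA hx he]
  split_ifs
  exacts [le_rfl, (hx.1 j).1]

lemma Xe_eq_zero_or_eq (hl : 0 < l) (hA : ∀ i j, A i j ∈ Set.Icc (0 : ℝ) 1)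
    (hx : x ∈ feasible l A b) (he : ∀ i, dombi l (A i (e i)) (x (e i)) = b i)
    (j : Fin (n + 1)) : Xe l A b e j = 0 ∨ Xe l A b e j = x j := by
  obtain ⟨i, -, hi⟩ := Finset.exists_mem_eq_sup' Finset.univ_nonempty
    (fun i => xcheck l A b i (e i) j)
  rw [Xe, hi, xcheck_eq_ite hl hA hx he]
  split_ifs <;> simp

lemma Xe_apply_of_pos (hl : 0 < l) (hA : ∀ i j, A i j ∈ Set.Icc (0 : ℝ) 1)
    (hx : x ∈ feasible l A b) (he : ∀ i, dombi l (A i (e i)) (x (e i)) = b i)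
    {i : Fin (m + 1)} (h0 : 0 < b i) : Xe l A b e (e i) = x (e i) := by
  refine (Xe_le hl hA hx he _).antisymm ?_
  have h := Finset.le_sup' (fun k => xcheck l A b k (e k) (e i)) (Finset.mem_univ i)
  rwa [xcheck_eq_ite hl hA hx he, if_pos ⟨h0, rfl⟩] at h

lemma Xe_mem_feasible (hl : 0 < l) (hA : ∀ i j, A i j ∈ Set.Icc (0 : ℝ) 1)
    (hb : ∀ i, b i ∈ Set.Icc (0 : ℝ) 1) (hx : x ∈ feasible l A b)
    (he : ∀ i, dombi l (A i (e i)) (x (e i)) = b i) : Xe l A b e ∈ feasible l A b := by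
  refine ⟨fun j => ?_, fun i => le_antisymm (Finset.sup'_le _ _ fun j _ => ?_) ?_⟩
  · rcases Xe_eq_zero_or_eq hl hA hx he j with h | h <;> rw [h]
    exacts [⟨le_rfl, zero_le_one⟩, hx.1 j]
  · rcases Xe_eq_zero_or_eq hl hA hx he j with h | h <;> rw [h]
    exacts [(dombi_zero_right l _).trans_le (hb i).1, dombi_le_of_feasible hx i j]
  · refine le_trans ?_ (Finset.le_sup' (fun j => dombi l (A i j) (Xe l A b e j))
      (Finset.mem_univ (e i)))
    rcases (hb i).1.eq_or_lt with h0 | h0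
    · rcases Xe_eq_zero_or_eq hl hA hx he (e i) with h | h <;> simp only [h]
      exacts [h0.symm.trans_le (dombi_zero_right l _).ge, (he i).ge]
    · simp only [Xe_apply_of_pos hl hA hx he h0, (he i).ge]

end System

/-- (Corollary 2) Every minimal element of `S` equals `X(e)` for a selection `e` taking
values in the reduced index sets `J̄ᵢ`, each `J̄ᵢ ⊆ Jᵢ`, and consequently
`{X(e) : e ∈ Ē} ⊆ {X(e) : e ∈ E}`. -/
theorem minimal_is_Xe_reduced (l : ℝ) (hl : 0 < l) {m n : ℕ}
    (A : Fin (m + 1) → Fin (n + 1) → ℝ) (b : Fin (m + 1) → ℝ)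
    (hA : ∀ i j, A i j ∈ Set.Icc (0 : ℝ) 1) (hb : ∀ i, b i ∈ Set.Icc (0 : ℝ) 1) :
    (∀ x ∈ feasible l A b, (∀ z ∈ feasible l A b, (∀ j, z j ≤ x j) → z = x) →
      ∃ e : Fin (m + 1) → Fin (n + 1), (∀ i, b i ≤ Abar l A b i (e i)) ∧
        x = Xe l A b e) ∧
    (∀ i j, b i ≤ Abar l A b i j → b i ≤ A i j) ∧
    {x : Fin (n + 1) → ℝ | ∃ e : Fin (m + 1) → Fin (n + 1),
        (∀ i, b i ≤ Abar l A b i (e i)) ∧ x = Xe l A b e} ⊆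
      {x : Fin (n + 1) → ℝ | ∃ e : Fin (m + 1) → Fin (n + 1),
        (∀ i, b i ≤ A i (e i)) ∧ x = Xe l A b e} := by
  refine ⟨fun x hx hmin => ?_, fun i j => le_of_le_Abar hA, ?_⟩
  · choose e he using exists_dombi_eq_of_feasible hx
    exact ⟨e, fun i => le_Abar_of_dombi_eq hl hA hb hx (he i),
      (hmin _ (Xe_mem_feasible hl hA hb hx he) (Xe_le hl hA hx he)).symm⟩
  · rintro x ⟨e, he, rfl⟩
    exact ⟨e, fun i => le_of_le_Abar hA (he i), rfl⟩
end

section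
/- (Theorem 3) If the feasible set S of the max-Dombi system is nonempty, then there exists x̲* ∈ S that is a minimal element of S with respect to the componentwise order and that is optimal for the latticized program: max_{j=1..n} x̲*_j ≤ max_{j=1..n} x_j for every x ∈ S. -/
open scoped Classical

theorem dombi_nonneg {l a y : ℝ} (ha : a ∈ Set.Icc (0 : ℝ) 1) (hy : y ∈ Set.Icc (0 : ℝ) 1) :
    0 ≤ dombi l a y := by
  have h1 : 0 ≤ (1 - a) / a := div_nonneg (sub_nonneg.2 ha.2) ha.1
  have h2 : 0 ≤ (1 - y) / y := div_nonneg (sub_nonneg.2 hy.2) hy.1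
  unfold dombi
  split_ifs
  · exact le_rfl
  · positivity

theorem dombi_le_right {l a y : ℝ} (hl : 0 < l) (ha : a ∈ Set.Icc (0 : ℝ) 1)
    (hy : y ∈ Set.Icc (0 : ℝ) 1) : dombi l a y ≤ y := by
  have h1 : 0 ≤ (1 - a) / a := div_nonneg (sub_nonneg.2 ha.2) ha.1
  have h2 : 0 ≤ (1 - y) / y := div_nonneg (sub_nonneg.2 hy.2) hy.1
  unfold dombi
  split_ifs with h
  · exact hy.1
  · have hy0 : y ≠ 0 := fun e => h (Or.inr e)
    have key : (1 - y) / y ≤ (((1 - a) / a) ^ l + ((1 - y) / y) ^ l) ^ (1 / l) := by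
      calc (1 - y) / y = (((1 - y) / y) ^ l) ^ (1 / l) := by
            rw [one_div, Real.rpow_rpow_inv h2 hl.ne']
        _ ≤ _ := by
            gcongr
            exact le_add_of_nonneg_left (by positivity)
    calc _ ≤ (1 + (1 - y) / y)⁻¹ := by gcongr
      _ = y := by field_simp; ring

/-- The Dombi t-norm is continuous in its second argument on the unit interval. -/
theorem continuousOn_dombi {l a : ℝ} (hl : 0 < l) (ha : a ∈ Set.Icc (0 : ℝ) 1) :
    ContinuousOn (dombi l a) (Set.Icc 0 1) := by
  by_cases ha0 : a = 0
  · have : dombi l a = fun _ => 0 := by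
      funext y
      simp [dombi, ha0]
    rw [this]
    exact continuousOn_const
  intro y hy
  by_cases hy0 : y = 0
  · subst hy0
    have h0 : dombi l a 0 = 0 := by simp [dombi]
    rw [ContinuousWithinAt, h0]
    refine tendsto_of_tendsto_of_tendsto_of_le_of_le' tendsto_const_nhds
      (continuousWithinAt_id (x := (0 : ℝ)) (s := Set.Icc 0 1)) ?_ ?_
    · filter_upwards [self_mem_nhdsWithin] with z hz using dombi_nonneg ha hz
    · filter_upwards [self_mem_nhdsWithin] with z hz using dombi_le_right hl ha hz
  · have h1 : 0 ≤ (1 - a) / a := div_nonneg (sub_nonneg.2 ha.2) ha.1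
    have h2 : 0 ≤ (1 - y) / y := div_nonneg (sub_nonneg.2 hy.2) hy.1
    have hc : ContinuousAt
        (fun y => (1 + (((1 - a) / a) ^ l + ((1 - y) / y) ^ l) ^ (1 / l))⁻¹) y := by
      have hq : ContinuousAt (fun y : ℝ => (1 - y) / y) y :=
        (continuousAt_const.sub continuousAt_id).div continuousAt_id hy0
      refine ContinuousAt.inv₀ (continuousAt_const.add
        ((continuousAt_const.add (hq.rpow_const (Or.inr hl.le))).rpow_const
          (Or.inr (by positivity)))) ?_
      positivity
    refine (hc.congr ?_).continuousWithinAt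
    filter_upwards [isOpen_ne.mem_nhds hy0] with z hz
    simp only [dombi, ha0, false_or]
    rw [if_neg hz]

theorem isCompact_feasible {l : ℝ} (hl : 0 < l) {m n : ℕ}
    {A : Fin (m + 1) → Fin (n + 1) → ℝ} {b : Fin (m + 1) → ℝ}
    (hA : ∀ i j, A i j ∈ Set.Icc (0 : ℝ) 1) : IsCompact (feasible l A b) := by
  let K : Set (Fin (n + 1) → ℝ) := Set.univ.pi fun _ => Set.Icc 0 1
  have hK : IsCompact K := isCompact_univ_pi fun _ => isCompact_Icc
  let F : (Fin (n + 1) → ℝ) → Fin (m + 1) → ℝ := fun x i =>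
    Finset.univ.sup' Finset.univ_nonempty fun j => dombi l (A i j) (x j)
  have hF : ContinuousOn F K := continuousOn_pi.2 fun i =>
    ContinuousOn.finset_sup'_apply _ fun j _ =>
      (continuousOn_dombi hl (hA i j)).comp (continuous_apply j).continuousOn
        fun x hx => hx j trivial
  have hS : feasible l A b = K ∩ F ⁻¹' {b} := by
    ext x
    simp only [feasible, K, F, funext_iff, Set.mem_ofPred_eq, Set.mem_inter_iff, Set.mem_univ_pi,
      Set.mem_preimage, Set.mem_singleton_iff]
  rw [hS]
  exact hK.of_isClosed_subset
    (hF.preimage_isClosed_of_isClosed hK.isClosed isClosed_singleton) Set.inter_subset_left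

/-- A nonempty compact set in `ℝ^ι` has a minimal element that also minimizes a given
continuous monotone function. -/
theorem IsCompact.exists_minimal_isMinOn {ι : Type*} [Fintype ι] {S : Set (ι → ℝ)}
    (hS : IsCompact S) (hne : S.Nonempty) {f : (ι → ℝ) → ℝ} (hf : Continuous f)
    (hmono : Monotone f) : ∃ x ∈ S, (∀ z ∈ S, z ≤ x → z = x) ∧ ∀ z ∈ S, f x ≤ f z := by
  obtain ⟨p, hp, hpmin⟩ := hS.exists_isMinOn hne hf.continuousOn
  have hT : IsCompact (S ∩ {x | f x ≤ f p}) :=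
    hS.inter_right (isClosed_le hf continuous_const)
  obtain ⟨x, ⟨hxS, hxp⟩, hxmin⟩ := hT.exists_isMinOn ⟨p, hp, le_refl (f p)⟩
    (f := fun x => ∑ j, x j) (by fun_prop)
  refine ⟨x, hxS, fun z hz hzx => ?_, fun z hz => le_trans hxp (hpmin hz)⟩
  have hsum : ∑ j, x j ≤ ∑ j, z j := hxmin ⟨hz, (hmono hzx).trans hxp⟩
  have heq := (Finset.sum_eq_sum_iff_of_le fun j _ => hzx j).1
    ((Finset.sum_le_sum fun j _ => hzx j).antisymm hsum)
  exact funext fun j => heq j (Finset.mem_univ j)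

/-- (Theorem 3) If `S` is nonempty, some minimal element of `S` minimizes the
latticized objective `z(x) = max {x₁, …, xₙ}` over `S`. -/
theorem exists_minimal_optimal (l : ℝ) (hl : 0 < l) {m n : ℕ}
    (A : Fin (m + 1) → Fin (n + 1) → ℝ) (b : Fin (m + 1) → ℝ)
    (hA : ∀ i j, A i j ∈ Set.Icc (0 : ℝ) 1) (hb : ∀ i, b i ∈ Set.Icc (0 : ℝ) 1)
    (hS : (feasible l A b).Nonempty) :
    ∃ xstar ∈ feasible l A b,
      (∀ z ∈ feasible l A b, (∀ j, z j ≤ xstar j) → z = xstar) ∧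
      ∀ x ∈ feasible l A b,
        Finset.univ.sup' Finset.univ_nonempty xstar ≤
          Finset.univ.sup' Finset.univ_nonempty x := by
  exact (isCompact_feasible hl hA).exists_minimal_isMinOn hS
    (f := fun x => Finset.univ.sup' Finset.univ_nonempty x)
    (Continuous.finset_sup'_apply _ fun j _ => continuous_apply j)
    (fun _ _ h => Finset.sup'_mono_fun fun j _ => h j)
end
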